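/- Let (u,v) be a smooth solution of the Pavlov–Mikhalev system on ℝ³. Then the pair (φ^u, φ^v) with φ^u = 0 and φ^v = u_x·u_xxx + u_xxy + (1/2)·u_xx² satisfies the linearized system, i.e., it is a symmetry generating function (the symmetry φ₉). -/

import Mathlib

noncomputable section

/-- Partial derivative with respect to the first coordinate `t`. -/
def Dt (f : ℝ → ℝ → ℝ → ℝ) : ℝ → ℝ → ℝ → ℝ := fun t x y => deriv (fun s => f s x y) t

/-- Partial derivative with respect to the second coordinate `x`. -/
def Dx (f : ℝ → ℝ → ℝ → ℝ) : ℝ → ℝ → ℝ → ℝ := fun t x y => deriv (fun s => f t s y) x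

/-- Partial derivative with respect to the third coordinate `y`. -/
def Dy (f : ℝ → ℝ → ℝ → ℝ) : ℝ → ℝ → ℝ → ℝ := fun t x y => deriv (fun s => f t x s) y

/-- `f` is a smooth function on `ℝ³` (given in curried form, coordinates `(t, x, y)`). -/
def Smooth3 (f : ℝ → ℝ → ℝ → ℝ) : Prop :=
  ContDiff ℝ (⊤ : ℕ∞) (fun p : ℝ × ℝ × ℝ => f p.1 p.2.1 p.2.2)

/-- The Pavlov–Mikhalev equation `u_yy = u_xt − u_x·u_xy + u_y·u_xx`. -/
def PMu (u : ℝ → ℝ → ℝ → ℝ) : Prop :=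
  ∀ t x y : ℝ, Dy (Dy u) t x y =
    Dt (Dx u) t x y - Dx u t x y * Dy (Dx u) t x y + Dy u t x y * Dx (Dx u) t x y

/-- The second equation of the two-component Pavlov–Mikhalev system:
`v_yy = v_xt − u_x·v_xy − 2·v_y·u_xx + 2·v_x·u_xy + u_y·v_xx`. -/
def PMv (u v : ℝ → ℝ → ℝ → ℝ) : Prop :=
  ∀ t x y : ℝ, Dy (Dy v) t x y =
    Dt (Dx v) t x y - Dx u t x y * Dy (Dx v) t x y
      - 2 * Dy v t x y * Dx (Dx u) t x y + 2 * Dx v t x y * Dy (Dx u) t x y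
      + Dy u t x y * Dx (Dx v) t x y

/-- First equation of the linearized system applied to `A = φ^u`:
`φ^u_yy = φ^u_xt + u_xx·φ^u_y + u_y·φ^u_xx − u_x·φ^u_xy − u_xy·φ^u_x`. -/
def LinU (u A : ℝ → ℝ → ℝ → ℝ) : Prop :=
  ∀ t x y : ℝ, Dy (Dy A) t x y =
    Dt (Dx A) t x y + Dx (Dx u) t x y * Dy A t x y + Dy u t x y * Dx (Dx A) t x y
      - Dx u t x y * Dy (Dx A) t x y - Dy (Dx u) t x y * Dx A t x y

/-- Second equation of the linearized system applied to `(A, B) = (φ^u, φ^v)`. -/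
def LinV (u v A B : ℝ → ℝ → ℝ → ℝ) : Prop :=
  ∀ t x y : ℝ, Dy (Dy B) t x y =
    2 * Dx v t x y * Dy (Dx A) t x y - Dy (Dx v) t x y * Dx A t x y
      + Dx (Dx v) t x y * Dy A t x y - 2 * Dy v t x y * Dx (Dx A) t x y
      + Dt (Dx B) t x y + 2 * Dy (Dx u) t x y * Dx B t x y
      - 2 * Dx (Dx u) t x y * Dy B t x y + Dy u t x y * Dx (Dx B) t x y
      - Dx u t x y * Dy (Dx B) t x y

/-- `(A,B)` is a symmetry generating function of the Pavlov–Mikhalev system over `(u,v)`. -/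
def IsSymmetry (u v A B : ℝ → ℝ → ℝ → ℝ) : Prop := LinU u A ∧ LinV u v A B

/-- First equation of the tangent system over a solution `(u,v)`:
`p_yy = u_y·p_xx − u_xy·p_x − u_x·p_xy + u_xx·p_y + p_xt`. -/
def TanP (u p : ℝ → ℝ → ℝ → ℝ) : Prop :=
  ∀ t x y : ℝ, Dy (Dy p) t x y =
    Dy u t x y * Dx (Dx p) t x y - Dy (Dx u) t x y * Dx p t x y
      - Dx u t x y * Dy (Dx p) t x y + Dx (Dx u) t x y * Dy p t x y + Dt (Dx p) t x y

/-- Second equation of the tangent system over a solution `(u,v)`: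
`q_yy = 2·v_x·p_xy + v_xx·p_y − v_xy·p_x − 2·v_y·p_xx + 2·u_xy·q_x + u_y·q_xx
  − u_x·q_xy − 2·u_xx·q_y + q_xt`. -/
def TanQ (u v p q : ℝ → ℝ → ℝ → ℝ) : Prop :=
  ∀ t x y : ℝ, Dy (Dy q) t x y =
    2 * Dx v t x y * Dy (Dx p) t x y + Dx (Dx v) t x y * Dy p t x y
      - Dy (Dx v) t x y * Dx p t x y - 2 * Dy v t x y * Dx (Dx p) t x y
      + 2 * Dy (Dx u) t x y * Dx q t x y + Dy u t x y * Dx (Dx q) t x y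
      - Dx u t x y * Dy (Dx q) t x y - 2 * Dx (Dx u) t x y * Dy q t x y
      + Dt (Dx q) t x y


/-- A curried function of three variables, as a function on the product. -/
def uncurry3 (f : ℝ → ℝ → ℝ → ℝ) : ℝ × ℝ × ℝ → ℝ := fun p => f p.1 p.2.1 p.2.2

namespace Smooth3

variable {f g : ℝ → ℝ → ℝ → ℝ}

lemma differentiable (hf : Smooth3 f) : Differentiable ℝ (uncurry3 f) :=
  ContDiff.differentiable hf (by simp)

lemma Dt_eq_fderiv (hf : Smooth3 f) :
    Dt f = fun t x y => fderiv ℝ (uncurry3 f) (t, x, y) (1, 0, 0) := by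
  funext t x y
  have hc : HasDerivAt (fun s : ℝ => (s, x, y)) ((1 : ℝ), (0 : ℝ), (0 : ℝ)) t :=
    (hasDerivAt_id t).prodMk (hasDerivAt_const t (x, y))
  exact ((hf.differentiable (t, x, y)).hasFDerivAt.comp_hasDerivAt t hc).deriv

lemma Dx_eq_fderiv (hf : Smooth3 f) :
    Dx f = fun t x y => fderiv ℝ (uncurry3 f) (t, x, y) (0, 1, 0) := by
  funext t x y
  have hc : HasDerivAt (fun s : ℝ => (t, s, y)) ((0 : ℝ), (1 : ℝ), (0 : ℝ)) x :=
    (hasDerivAt_const x t).prodMk ((hasDerivAt_id x).prodMk (hasDerivAt_const x y))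
  exact ((hf.differentiable (t, x, y)).hasFDerivAt.comp_hasDerivAt x hc).deriv

lemma Dy_eq_fderiv (hf : Smooth3 f) :
    Dy f = fun t x y => fderiv ℝ (uncurry3 f) (t, x, y) (0, 0, 1) := by
  funext t x y
  have hc : HasDerivAt (fun s : ℝ => (t, x, s)) ((0 : ℝ), (0 : ℝ), (1 : ℝ)) y :=
    (hasDerivAt_const y t).prodMk ((hasDerivAt_const y x).prodMk (hasDerivAt_id y))
  exact ((hf.differentiable (t, x, y)).hasFDerivAt.comp_hasDerivAt y hc).deriv

lemma fderiv_apply (hf : Smooth3 f) (w : ℝ × ℝ × ℝ) :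
    Smooth3 fun t x y => fderiv ℝ (uncurry3 f) (t, x, y) w :=
  (ContDiff.fderiv_right (m := (⊤ : ℕ∞)) hf (by simp)).clm_apply contDiff_const

lemma fderiv_fderiv_comm (hf : Smooth3 f) (p w z : ℝ × ℝ × ℝ) :
    fderiv ℝ (uncurry3 fun t x y => fderiv ℝ (uncurry3 f) (t, x, y) w) p z =
      fderiv ℝ (uncurry3 fun t x y => fderiv ℝ (uncurry3 f) (t, x, y) z) p w := by
  have hd : DifferentiableAt ℝ (fderiv ℝ (uncurry3 f)) p :=
    (ContDiff.fderiv_right (m := (⊤ : ℕ∞)) hf (by simp)).differentiable (by simp) p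
  have key (a b : ℝ × ℝ × ℝ) :
      fderiv ℝ (uncurry3 fun t x y => fderiv ℝ (uncurry3 f) (t, x, y) a) p b =
        fderiv ℝ (fderiv ℝ (uncurry3 f)) p b a := by
    change fderiv ℝ (fun q => fderiv ℝ (uncurry3 f) q a) p b = _
    rw [fderiv_clm_apply hd (differentiableAt_const a)]
    simp
  have hs : IsSymmSndFDerivAt ℝ (uncurry3 f) p :=
    (ContDiff.contDiffAt hf).isSymmSndFDerivAt (by
      simpa using (mod_cast le_top : ((2 : ℕ∞) : WithTop ℕ∞) ≤ ((⊤ : ℕ∞) : WithTop ℕ∞)))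
  rw [key, key, hs.eq]

lemma dt (hf : Smooth3 f) : Smooth3 (Dt f) := hf.Dt_eq_fderiv ▸ hf.fderiv_apply _

lemma dx (hf : Smooth3 f) : Smooth3 (Dx f) := hf.Dx_eq_fderiv ▸ hf.fderiv_apply _

lemma dy (hf : Smooth3 f) : Smooth3 (Dy f) := hf.Dy_eq_fderiv ▸ hf.fderiv_apply _

lemma Dx_Dt (hf : Smooth3 f) : Dx (Dt f) = Dt (Dx f) := by
  rw [hf.dt.Dx_eq_fderiv, hf.dx.Dt_eq_fderiv, hf.Dt_eq_fderiv, hf.Dx_eq_fderiv]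
  funext t x y
  exact hf.fderiv_fderiv_comm _ _ _

lemma Dx_Dy (hf : Smooth3 f) : Dx (Dy f) = Dy (Dx f) := by
  rw [hf.dy.Dx_eq_fderiv, hf.dx.Dy_eq_fderiv, hf.Dy_eq_fderiv, hf.Dx_eq_fderiv]
  funext t x y
  exact hf.fderiv_fderiv_comm _ _ _

lemma Dy_Dt (hf : Smooth3 f) : Dy (Dt f) = Dt (Dy f) := by
  rw [hf.dt.Dy_eq_fderiv, hf.dy.Dt_eq_fderiv, hf.Dt_eq_fderiv, hf.Dy_eq_fderiv]
  funext t x y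
  exact hf.fderiv_fderiv_comm _ _ _

lemma add (hf : Smooth3 f) (hg : Smooth3 g) : Smooth3 (f + g) := ContDiff.add hf hg

lemma sub (hf : Smooth3 f) (hg : Smooth3 g) : Smooth3 (f - g) := ContDiff.sub hf hg

lemma mul (hf : Smooth3 f) (hg : Smooth3 g) : Smooth3 (f * g) := ContDiff.mul hf hg

lemma const_smul (c : ℝ) (hf : Smooth3 f) : Smooth3 (c • f) := ContDiff.const_smul c hf

lemma differentiableAt_t (hf : Smooth3 f) (t x y : ℝ) :
    DifferentiableAt ℝ (fun s => f s x y) t :=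
  (hf.differentiable (t, x, y)).comp (f := fun s : ℝ => (s, x, y)) t (by fun_prop)

lemma differentiableAt_x (hf : Smooth3 f) (t x y : ℝ) :
    DifferentiableAt ℝ (fun s => f t s y) x :=
  (hf.differentiable (t, x, y)).comp (f := fun s : ℝ => (t, s, y)) x (by fun_prop)

lemma differentiableAt_y (hf : Smooth3 f) (t x y : ℝ) :
    DifferentiableAt ℝ (fun s => f t x s) y :=
  (hf.differentiable (t, x, y)).comp (f := fun s : ℝ => (t, x, s)) y (by fun_prop)

lemma Dt_add (hf : Smooth3 f) (hg : Smooth3 g) : Dt (f + g) = Dt f + Dt g := by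
  funext t x y
  exact deriv_add (hf.differentiableAt_t t x y) (hg.differentiableAt_t t x y)

lemma Dt_mul (hf : Smooth3 f) (hg : Smooth3 g) :
    Dt (f * g) = Dt f * g + f * Dt g := by
  funext t x y
  exact deriv_mul (hf.differentiableAt_t t x y) (hg.differentiableAt_t t x y)

lemma Dt_const_smul (c : ℝ) (hf : Smooth3 f) : Dt (c • f) = c • Dt f := by
  funext t x y
  exact deriv_const_smul c (hf.differentiableAt_t t x y)

lemma Dx_add (hf : Smooth3 f) (hg : Smooth3 g) : Dx (f + g) = Dx f + Dx g := by
  funext t x y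
  exact deriv_add (hf.differentiableAt_x t x y) (hg.differentiableAt_x t x y)

lemma Dx_sub (hf : Smooth3 f) (hg : Smooth3 g) : Dx (f - g) = Dx f - Dx g := by
  funext t x y
  exact deriv_sub (hf.differentiableAt_x t x y) (hg.differentiableAt_x t x y)

lemma Dx_mul (hf : Smooth3 f) (hg : Smooth3 g) :
    Dx (f * g) = Dx f * g + f * Dx g := by
  funext t x y
  exact deriv_mul (hf.differentiableAt_x t x y) (hg.differentiableAt_x t x y)

lemma Dx_const_smul (c : ℝ) (hf : Smooth3 f) : Dx (c • f) = c • Dx f := by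
  funext t x y
  exact deriv_const_smul c (hf.differentiableAt_x t x y)

lemma Dy_add (hf : Smooth3 f) (hg : Smooth3 g) : Dy (f + g) = Dy f + Dy g := by
  funext t x y
  exact deriv_add (hf.differentiableAt_y t x y) (hg.differentiableAt_y t x y)

lemma Dy_sub (hf : Smooth3 f) (hg : Smooth3 g) : Dy (f - g) = Dy f - Dy g := by
  funext t x y
  exact deriv_sub (hf.differentiableAt_y t x y) (hg.differentiableAt_y t x y)

lemma Dy_mul (hf : Smooth3 f) (hg : Smooth3 g) :
    Dy (f * g) = Dy f * g + f * Dy g := by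
  funext t x y
  exact deriv_mul (hf.differentiableAt_y t x y) (hg.differentiableAt_y t x y)

lemma Dy_const_smul (c : ℝ) (hf : Smooth3 f) : Dy (c • f) = c • Dy f := by
  funext t x y
  exact deriv_const_smul c (hf.differentiableAt_y t x y)

end Smooth3

theorem phi9_is_symmetry (u v : ℝ → ℝ → ℝ → ℝ) (hu : Smooth3 u) (hv : Smooth3 v)
    (hPMu : PMu u) (hPMv : PMv u v) :
    IsSymmetry u v
      (fun _t _x _y => (0 : ℝ))
      (fun t x y => Dx u t x y * Dx (Dx (Dx u)) t x y + Dy (Dx (Dx u)) t x y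
        + (1/2) * (Dx (Dx u) t x y)^2) := by
  have hE : Dy (Dy u) = Dt (Dx u) - Dx u * Dy (Dx u) + Dy u * Dx (Dx u) := by
    funext t x y
    exact hPMu t x y
  have hB : (fun t x y => Dx u t x y * Dx (Dx (Dx u)) t x y + Dy (Dx (Dx u)) t x y
        + (1/2) * (Dx (Dx u) t x y)^2) =
      Dx u * Dx (Dx (Dx u)) + Dy (Dx (Dx u)) + (1 / 2 : ℝ) • (Dx (Dx u) * Dx (Dx u)) := by
    funext t x y
    simp only [Pi.add_apply, Pi.mul_apply, Pi.smul_apply, smul_eq_mul]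
    ring
  have hEx := congrArg Dx hE
  have hExx := congrArg Dx hEx
  have hExxx := congrArg Dx hExx
  have hExxy := congrArg Dy hExx
  refine ⟨fun t x y => by simp [Dt, Dx, Dy], fun t x y => ?_⟩
  rw [hB]
  replace hE := congrFun (congrFun (congrFun hE t) x) y
  replace hEx := congrFun (congrFun (congrFun hEx t) x) y
  replace hExx := congrFun (congrFun (congrFun hExx t) x) y
  replace hExxx := congrFun (congrFun (congrFun hExxx t) x) y
  replace hExxy := congrFun (congrFun (congrFun hExxy t) x) y
  have hx : Dx (fun _ _ _ => (0 : ℝ)) = fun _ _ _ => 0 := by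
    funext t x y
    simp [Dx]
  have hy : Dy (fun _ _ _ => (0 : ℝ)) = fun _ _ _ => 0 := by
    funext t x y
    simp [Dy]
  simp (maxDischargeDepth := 20) only [hu, hx, hy, Smooth3.dt, Smooth3.dx, Smooth3.dy, Smooth3.add, Smooth3.sub,
    Smooth3.mul, Smooth3.const_smul, Smooth3.Dx_Dt, Smooth3.Dx_Dy, Smooth3.Dy_Dt,
    Smooth3.Dt_add, Smooth3.Dt_mul, Smooth3.Dt_const_smul,
    Smooth3.Dx_add, Smooth3.Dx_sub, Smooth3.Dx_mul, Smooth3.Dx_const_smul,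
    Smooth3.Dy_add, Smooth3.Dy_sub, Smooth3.Dy_mul, Smooth3.Dy_const_smul,
    Pi.add_apply, Pi.sub_apply, Pi.mul_apply, Pi.smul_apply, smul_eq_mul]
    at hE hEx hExx hExxx hExxy ⊢
  linear_combination hExxy + Dx u t x y * hExxx + 2 * Dx (Dx u) t x y * hExx +
    2 * Dx (Dx (Dx u)) t x y * hEx + Dx (Dx (Dx (Dx u))) t x y * hE
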